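/- arXiv:1810.03144 — 2 statements merged into one kernel-verified Lean document; each statement's English description precedes it below -/
import Mathlib

section
/- Let 0 < α < 1 and t > 0. Then E_{α,α}(−t) ≥ 0. -/
/-- The Mittag--Leffler function `E_{α,β}(z) = ∑_{k=0}^∞ z^k / Γ(kα + β)`. -/
noncomputable def mittagLeffler (α β z : ℝ) : ℝ :=
  ∑' k : ℕ, z ^ k / Real.Gamma (k * α + β)


/-- coefficients of `(1-x)^(-β)` -/
noncomputable def mlC (β : ℝ) (n : ℕ) : ℝ := (∏ j ∈ Finset.range n, (β + j)) / (n.factorial : ℝ)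

lemma mlC_zero_right (β : ℝ) : mlC β 0 = 1 := by simp [mlC]

lemma mlC_succ (β : ℝ) (n : ℕ) : mlC β (n + 1) = mlC β n * ((β + n) / (n + 1)) := by
  unfold mlC
  rw [Finset.prod_range_succ, Nat.factorial_succ]
  have : (n.factorial : ℝ) ≠ 0 := by positivity
  have : ((n : ℝ) + 1) ≠ 0 := by positivity
  push_cast
  field_simp

lemma mlC_nonneg {β : ℝ} (hβ : 0 ≤ β) (n : ℕ) : 0 ≤ mlC β n := by
  unfold mlC
  exact div_nonneg (Finset.prod_nonneg fun j _ => by positivity) (by positivity)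

lemma mlC_neg {α : ℝ} (h0 : 0 < α) (h1 : α < 1) (n : ℕ) : mlC (-α) (n + 1) ≤ 0 := by
  induction n with
  | zero => simp [mlC_succ, mlC_zero_right, h0.le]
  | succ n ih =>
    rw [mlC_succ]
    refine mul_nonpos_of_nonpos_of_nonneg ih (div_nonneg ?_ (by positivity))
    push_cast
    have : (0 : ℝ) ≤ n := by positivity
    linarith

lemma mlC_zero (n : ℕ) : mlC 0 (n + 1) = 0 := by
  induction n with
  | zero => simp [mlC_succ]
  | succ n ih => rw [mlC_succ, ih, zero_mul]

lemma mlC_eq (β : ℝ) (n : ℕ) : mlC β n = Ring.multichoose β n := by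
  have h := Ring.factorial_nsmul_multichoose_eq_ascPochhammer β n
  rw [Polynomial.ascPochhammer_smeval_eq_eval, nsmul_eq_mul] at h
  have h2 : (ascPochhammer ℝ n).eval β = ∏ j ∈ Finset.range n, (β + j) := by
    clear h
    induction n with
    | zero => simp
    | succ n ih => rw [ascPochhammer_succ_eval, ih, Finset.prod_range_succ]
  unfold mlC
  rw [← h2, ← h]
  have : (n.factorial : ℝ) ≠ 0 := by positivity
  field_simp

lemma mlC_choose (β : ℝ) (n : ℕ) : mlC β n = (-1) ^ n * Ring.choose (-β) n := by
  rw [Ring.choose_neg, mlC_eq, Ring.multichoose_eq, Units.smul_def, zsmul_eq_mul,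
    Int.cast_negOnePow_natCast, ← mul_assoc, ← mul_pow]
  simp

lemma mlC_add (β γ : ℝ) (n : ℕ) :
    mlC (β + γ) n = ∑ ij ∈ Finset.HasAntidiagonal.antidiagonal n, mlC β ij.1 * mlC γ ij.2 := by
  rw [mlC_choose, neg_add, Ring.add_choose_eq n (Commute.all _ _), Finset.mul_sum]
  refine Finset.sum_congr rfl fun ij h => ?_
  rw [mlC_choose, mlC_choose, ← Finset.HasAntidiagonal.mem_antidiagonal.mp h, pow_add]
  ring

lemma mlC_hasSum (β x : ℝ) (hx0 : 0 ≤ x) (hx1 : x < 1) :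
    HasSum (fun n => mlC β n * x ^ n) (1 / (1 - x) ^ β) := by
  have h := (Real.one_div_one_sub_rpow_hasFPowerSeriesOnBall_zero β).hasSum (y := x)
    (by simp [abs_of_nonneg hx0, enorm_eq_nnnorm, ← NNReal.coe_lt_coe, hx1])
  simp only [zero_add, FormalMultilinearSeries.ofScalars_apply_eq, smul_eq_mul,
    ← Ring.multichoose_eq, ← mlC_eq] at h
  exact h

lemma mlC_partial (β : ℝ) (hβ : 0 < β) (n : ℕ) :
    ∑ j ∈ Finset.range (n + 1), mlC β j = (n + β) / β * mlC β n := by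
  induction n with
  | zero => simp [mlC_zero_right, hβ.ne']
  | succ n ih =>
    rw [Finset.sum_range_succ, ih, mlC_succ]
    have : ((n : ℝ) + 1) ≠ 0 := by positivity
    push_cast
    field_simp
    ring

/-- main bound -/
lemma mlC_bound (β x : ℝ) (hβ : 0 < β) (hx0 : 0 < x) (hx1 : x < 1) (n : ℕ) :
    (n + β) * mlC β n ≤ β * (x ^ n)⁻¹ * (1 / (1 - x) ^ β) := by
  have h1 : ∑ j ∈ Finset.range (n + 1), mlC β j * x ^ j ≤ 1 / (1 - x) ^ β :=
    sum_le_hasSum _ (fun j _ => mul_nonneg (mlC_nonneg hβ.le j) (by positivity))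
      (mlC_hasSum β x hx0.le hx1)
  have h2 : x ^ n * ∑ j ∈ Finset.range (n + 1), mlC β j
      ≤ ∑ j ∈ Finset.range (n + 1), mlC β j * x ^ j := by
    rw [Finset.mul_sum]
    refine Finset.sum_le_sum fun j hj => ?_
    rw [mul_comm]
    refine mul_le_mul_of_nonneg_left ?_ (mlC_nonneg hβ.le j)
    exact pow_le_pow_of_le_one hx0.le hx1.le (by simpa [Nat.lt_succ_iff] using hj)
  have h3 := h2.trans h1
  rw [mlC_partial β hβ] at h3
  have hxn : 0 < x ^ n := by positivity
  calc (n + β) * mlC β n = β * (x ^ n)⁻¹ * (x ^ n * ((n + β) / β * mlC β n)) := by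
        field_simp
    _ ≤ _ := mul_le_mul_of_nonneg_left h3 (by positivity)

/-- The discretised resolvent is nonnegative. -/
lemma ml_disc_nonneg (α s : ℝ) (h0 : 0 < α) (h1 : α < 1) (hs : 0 ≤ s)
    (hsum : ∀ n, Summable fun k : ℕ => (-s) ^ k * mlC (α * (k + 1)) n) (n : ℕ) :
    0 ≤ ∑' k : ℕ, (-s) ^ k * mlC (α * (k + 1)) n := by
  set u : ℕ → ℝ := fun n => ∑' k : ℕ, (-s) ^ k * mlC (α * (k + 1)) n with hu
  have key : ∀ n, ∑ ij ∈ Finset.HasAntidiagonal.antidiagonal n, mlC (-α) ij.1 * u ij.2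
      = mlC 0 n - s * u n := by
    intro n
    have e1 : HasSum (fun k : ℕ => ∑ ij ∈ Finset.HasAntidiagonal.antidiagonal n,
        mlC (-α) ij.1 * ((-s) ^ k * mlC (α * (k + 1)) ij.2))
        (∑ ij ∈ Finset.HasAntidiagonal.antidiagonal n, mlC (-α) ij.1 * u ij.2) :=
      hasSum_sum fun ij _ => (hsum ij.2).hasSum.mul_left _
    have e2 : (fun k : ℕ => ∑ ij ∈ Finset.HasAntidiagonal.antidiagonal n,
        mlC (-α) ij.1 * ((-s) ^ k * mlC (α * (k + 1)) ij.2))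
        = fun k : ℕ => (-s) ^ k * mlC (α * k) n := by
      funext k
      rw [show α * (k : ℝ) = -α + α * (k + 1) by ring, mlC_add, Finset.mul_sum]
      exact Finset.sum_congr rfl fun _ _ => by ring
    rw [e2] at e1
    have e3 : HasSum (fun k : ℕ => (-s) ^ (k + 1) * mlC (α * ((k + 1 : ℕ) : ℝ)) n)
        (-s * u n) := by
      have e5 := (hsum n).hasSum.mul_left (-s)
      have e6 : (fun k : ℕ => (-s) ^ (k + 1) * mlC (α * ((k + 1 : ℕ) : ℝ)) n)
          = fun k : ℕ => -s * ((-s) ^ k * mlC (α * (k + 1)) n) := by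
        funext k
        push_cast
        ring
      rw [e6]
      exact e5
    have e4 := (hasSum_nat_add_iff (f := fun k : ℕ => (-s) ^ k * mlC (α * k) n) 1).mp e3
    have := e1.unique e4
    rw [this]
    simp
    ring
  change 0 ≤ u n
  induction n using Nat.strong_induction_on with
  | _ n ih =>
    have hk := key n
    cases n with
    | zero =>
      simp [mlC_zero_right] at hk
      nlinarith
    | succ m =>
      rw [mlC_zero, Finset.Nat.antidiagonal_succ] at hk
      simp only [Finset.sum_cons, Finset.sum_map, mlC_zero_right] at hk
      have : ∑ ij ∈ Finset.HasAntidiagonal.antidiagonal m, mlC (-α) (ij.1 + 1) * u ij.2 ≤ 0 := by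
        refine Finset.sum_nonpos fun ij hij => ?_
        refine mul_nonpos_of_nonpos_of_nonneg (mlC_neg h0 h1 _) (ih _ ?_)
        have := Finset.HasAntidiagonal.mem_antidiagonal.mp hij
        omega
      simp at hk
      nlinarith

open Filter Topology in
lemma mlC_tendsto (β : ℝ) (hβ : 0 < β) :
    Tendsto (fun n : ℕ => (n : ℝ) * mlC β n * (n : ℝ) ^ (-β)) atTop
      (𝓝 (1 / Real.Gamma β)) := by
  have h1 : Tendsto (fun n : ℕ => (n : ℝ) / (n + β)) atTop (𝓝 1) :=
    tendsto_natCast_div_add_atTop β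
  have h2 := h1.div (Real.GammaSeq_tendsto_Gamma β) (Real.Gamma_pos_of_pos hβ).ne'
  refine h2.congr' ?_
  filter_upwards [eventually_gt_atTop 0] with n hn
  have hn' : (0 : ℝ) < n := by exact_mod_cast hn
  have hp : 0 < (n : ℝ) ^ β := Real.rpow_pos_of_pos hn' _
  have hprod : 0 < ∏ j ∈ Finset.range n, (β + (j : ℝ)) :=
    Finset.prod_pos fun j _ => by positivity
  simp only [Pi.div_apply]
  unfold Real.GammaSeq mlC
  rw [Finset.prod_range_succ, Real.rpow_neg hn'.le]
  have : (n.factorial : ℝ) ≠ 0 := by positivity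
  have : (n : ℝ) + β ≠ 0 := by positivity
  have : β + (n : ℝ) ≠ 0 := by positivity
  field_simp
  try ring

/-- Scaled bound, uniform in `n`. -/
lemma mlC_scaled (β L : ℝ) (hβ : 0 < β) (hL : 0 < L) (n : ℕ) (hn0 : 0 < n) (hn : 2 * L ≤ n) :
    (n : ℝ) * mlC β n * (n : ℝ) ^ (-β) ≤ β * Real.exp (2 * L) * L ^ (-β) := by
  have hn' : (0 : ℝ) < n := by exact_mod_cast hn0
  set y : ℝ := 2 * L / n with hy
  have hy0 : 0 < y := by positivity
  have hy1 : y ≤ 1 := by rw [hy, div_le_one hn']; exact hn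
  have hb := mlC_bound β (Real.exp (-y)) hβ (Real.exp_pos _) (by simpa using hy0) n
  have hx : (Real.exp (-y) ^ n)⁻¹ = Real.exp (2 * L) := by
    rw [← Real.exp_nat_mul, ← Real.exp_neg]
    congr 1
    rw [hy]; field_simp
  have hx2 : L / n ≤ 1 - Real.exp (-y) := by
    have e1 : Real.exp (-y) ≤ 1 / (1 + y) := by
      rw [Real.exp_neg, ← one_div]
      exact one_div_le_one_div_of_le (by positivity) (by linarith [Real.add_one_le_exp y])
    have e2 : 1 / (1 + y) ≤ 1 - y / 2 := by
      rw [div_le_iff₀ (by positivity)]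
      nlinarith
    have e3 : y / 2 = L / n := by rw [hy]; ring
    linarith
  have hLn : 0 < L / n := by positivity
  have h4 : 1 / (1 - Real.exp (-y)) ^ β ≤ 1 / (L / n) ^ β :=
    one_div_le_one_div_of_le (Real.rpow_pos_of_pos hLn _)
      (Real.rpow_le_rpow hLn.le hx2 hβ.le)
  rw [hx] at hb
  have hc := mlC_nonneg hβ.le n
  have hp : 0 < (n : ℝ) ^ β := Real.rpow_pos_of_pos hn' _
  have hp2 : 0 < L ^ β := Real.rpow_pos_of_pos hL _
  have h5 : (n : ℝ) * mlC β n ≤ β * Real.exp (2 * L) * (1 / (L / n) ^ β) := by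
    have := mul_le_mul_of_nonneg_left h4 (by positivity : 0 ≤ β * Real.exp (2 * L))
    nlinarith [mul_nonneg hβ.le hc]
  calc (n : ℝ) * mlC β n * (n : ℝ) ^ (-β)
      ≤ β * Real.exp (2 * L) * (1 / (L / n) ^ β) * (n : ℝ) ^ (-β) :=
        mul_le_mul_of_nonneg_right h5 (Real.rpow_pos_of_pos hn' _).le
    _ = _ := by
      rw [Real.div_rpow hL.le hn'.le, Real.rpow_neg hn'.le, Real.rpow_neg hL.le]
      field_simp

lemma mlC_summable (α s : ℝ) (h0 : 0 < α) (hs : 0 ≤ s) (hs1 : s < 1) (n : ℕ) :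
    Summable fun k : ℕ => (-s) ^ k * mlC (α * (k + 1)) n := by
  -- choose x small with s * (1-x)^(-α) < 1
  have hcont : ContinuousAt (fun x : ℝ => s * (1 / (1 - x) ^ α)) 0 := by
    refine ContinuousAt.mul continuousAt_const (ContinuousAt.div continuousAt_const ?_ (by simp))
    exact ContinuousAt.rpow_const (by fun_prop) (Or.inl (by simp))
  have hev : ∀ᶠ x in nhds (0 : ℝ), s * (1 / (1 - x) ^ α) < 1 :=
    hcont.eventually_lt continuousAt_const (by simpa using hs1)
  have hev2 : ∀ᶠ x in nhdsWithin (0 : ℝ) (Set.Ioi 0), s * (1 / (1 - x) ^ α) < 1 ∧ x ∈ Set.Ioo (0:ℝ) 1 :=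
    (hev.filter_mono nhdsWithin_le_nhds).and (Ioo_mem_nhdsGT one_pos)
  obtain ⟨x, hx, hx0, hx1⟩ := hev2.exists
  set q := s * (1 / (1 - x) ^ α) with hq
  have h1x : 0 < 1 - x := by linarith
  have hq0 : 0 ≤ q := mul_nonneg hs (by positivity)
  refine Summable.of_norm_bounded (g := fun k : ℕ => (x ^ n)⁻¹ * (1 / (1 - x) ^ α) * q ^ k)
    ((summable_geometric_of_lt_one hq0 hx).mul_left _) fun k => ?_
  have hβ : 0 < α * ((k : ℝ) + 1) := by positivity
  have hc := mlC_nonneg hβ.le n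
  have hb := mlC_bound _ x hβ hx0 hx1 n
  have hb2 : mlC (α * (k + 1)) n ≤ (x ^ n)⁻¹ * (1 / (1 - x) ^ (α * ((k : ℝ) + 1))) := by
    refine le_of_mul_le_mul_left ?_ hβ
    have : 0 ≤ (n : ℝ) * mlC (α * (k + 1)) n := by positivity
    nlinarith
  have hpow : (1 - x) ^ (α * ((k : ℝ) + 1)) = (1 - x) ^ α * ((1 - x) ^ α) ^ k := by
    rw [mul_add, mul_one, Real.rpow_add h1x, Real.rpow_mul h1x.le, Real.rpow_natCast]
    ring
  rw [norm_mul, norm_pow, norm_neg, Real.norm_of_nonneg hs, Real.norm_of_nonneg hc]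
  calc s ^ k * mlC (α * (k + 1)) n
      ≤ s ^ k * ((x ^ n)⁻¹ * (1 / (1 - x) ^ (α * ((k : ℝ) + 1)))) :=
        mul_le_mul_of_nonneg_left hb2 (by positivity)
    _ = _ := by
      rw [hpow, hq, mul_pow, one_div_pow]
      field_simp

open Filter Topology in
theorem mittagLeffler_nonneg (α t : ℝ) (hα0 : 0 < α) (hα1 : α < 1) (ht : 0 < t) :
    0 ≤ mittagLeffler α α (-t) := by
  set L : ℝ := (2 * t) ^ (1 / α) with hLdef
  have hL : 0 < L := by positivity
  have hLα : L ^ α = 2 * t := by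
    rw [hLdef, ← Real.rpow_mul (by positivity), one_div_mul_cancel hα0.ne', Real.rpow_one]
  have hlim : Tendsto (fun n : ℕ => ∑' k : ℕ, (-t) ^ k *
      ((n : ℝ) * mlC (α * (k + 1)) n * (n : ℝ) ^ (-(α * ((k : ℝ) + 1))))) atTop
      (𝓝 (∑' k : ℕ, (-t) ^ k * (1 / Real.Gamma (α * (k + 1))))) := by
    refine tendsto_tsum_of_dominated_convergence
      (bound := fun k : ℕ => α * Real.exp (2 * L) * (1 / (2 * t)) * (((k : ℝ) + 1) * (1 / 2) ^ k))
      ?_ ?_ ?_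
    · refine Summable.mul_left _ ?_
      have h1 : Summable fun k : ℕ => (k : ℝ) ^ 1 * (1 / 2 : ℝ) ^ k :=
        summable_pow_mul_geometric_of_norm_lt_one 1 (by norm_num)
      have h2 : Summable fun k : ℕ => (1 / 2 : ℝ) ^ k :=
        summable_geometric_of_lt_one (by norm_num) (by norm_num)
      refine (h1.add h2).congr fun k => ?_
      ring
    · intro k
      exact (mlC_tendsto _ (by positivity)).const_mul _
    · filter_upwards [eventually_gt_atTop 0, eventually_ge_atTop ⌈2 * L⌉₊] with n hn hn2 k
      have hβ : 0 < α * ((k : ℝ) + 1) := by positivity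
      have hb := mlC_scaled _ L hβ hL n hn (Nat.ceil_le.mp hn2)
      have hc := mlC_nonneg hβ.le n
      rw [norm_mul, norm_pow, norm_neg, Real.norm_of_nonneg ht.le,
        Real.norm_of_nonneg (by positivity)]
      refine (mul_le_mul_of_nonneg_left hb (by positivity)).trans (le_of_eq ?_)
      rw [Real.rpow_neg hL.le, Real.rpow_mul hL.le, hLα,
        show ((k : ℝ) + 1) = ((k + 1 : ℕ) : ℝ) by push_cast; ring, Real.rpow_natCast, pow_succ,
        mul_pow, one_div_pow]
      field_simp
  have hE : mittagLeffler α α (-t) = ∑' k : ℕ, (-t) ^ k * (1 / Real.Gamma (α * (k + 1))) := by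
    unfold mittagLeffler
    refine tsum_congr fun k => ?_
    rw [mul_one_div, show (k : ℝ) * α + α = α * (k + 1) by ring]
  rw [hE]
  refine ge_of_tendsto hlim ?_
  have hs : ∀ᶠ n : ℕ in atTop, t * (n : ℝ) ^ (-α) < 1 := by
    have := ((tendsto_rpow_neg_atTop hα0).comp tendsto_natCast_atTop_atTop).const_mul t
    rw [mul_zero] at this
    exact this.eventually_lt_const one_pos
  filter_upwards [eventually_gt_atTop 0, hs] with n hn hsn
  have hn' : (0 : ℝ) < n := by exact_mod_cast hn
  have hs0 : 0 ≤ t * (n : ℝ) ^ (-α) := by positivity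
  have h := ml_disc_nonneg α _ hα0 hα1 hs0 (fun m => mlC_summable α _ hα0 hs0 hsn m) n
  have h2 := mul_nonneg (by positivity : 0 ≤ (n : ℝ) * (n : ℝ) ^ (-α)) h
  rw [← tsum_mul_left] at h2
  refine h2.trans (le_of_eq (tsum_congr fun k => ?_))
  rw [show -(α * ((k : ℝ) + 1)) = -α + -α * k by ring, Real.rpow_add hn', Real.rpow_mul hn'.le,
    Real.rpow_natCast, ← neg_mul, mul_pow]
  ring
end

section
/- Let 1/2 < α < 1, T > 0 and λ₀ > 0. Then there exists a constant C > 0, depending only on α, T and λ₀, such that for every λ > 0, |∫_0^T τ^{2α−2} E_{α,α}(−λ₀ τ^α) E_{α,α}(−λ τ^α) dτ| ≤ C λ^{−1 + 1/(2α)}. -/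
open Set Filter Topology MeasureTheory

lemma ml_gamma_ratio (α x : ℝ) (hα : 0 < α) (hx : 1 < x) :
    (x - 1) ^ α * Real.Gamma x ≤ Real.Gamma (x + α) := by
  have hx1 : 0 < x - 1 := by linarith
  have hG : 0 < Real.Gamma (x - 1) := Real.Gamma_pos_of_pos hx1
  have hG2 : 0 < Real.Gamma (x + α) := Real.Gamma_pos_of_pos (by linarith)
  have hG0 : 0 < Real.Gamma x := Real.Gamma_pos_of_pos (by linarith)
  have h := Real.Gamma_mul_add_mul_le_rpow_Gamma_mul_rpow_Gamma (s := x - 1) (t := x + α)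
    (a := α / (1 + α)) (b := 1 / (1 + α)) hx1 (by linarith) (by positivity) (by positivity)
    (by field_simp; ring)
  have e : α / (1 + α) * (x - 1) + 1 / (1 + α) * (x + α) = x := by field_simp; ring
  rw [e] at h
  have hrec : Real.Gamma x = (x - 1) * Real.Gamma (x - 1) := by
    have := Real.Gamma_add_one hx1.ne'
    simpa using this
  have h2 := Real.rpow_le_rpow hG0.le h (z := 1 + α) (by linarith)
  rw [Real.mul_rpow (by positivity) (by positivity), ← Real.rpow_mul hG.le,
    ← Real.rpow_mul hG2.le, div_mul_cancel₀ _ (by positivity : (1 + α) ≠ 0),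
    div_mul_cancel₀ _ (by positivity : (1 + α) ≠ 0), Real.rpow_one, Real.rpow_add hG0,
    Real.rpow_one] at h2
  have h3 : Real.Gamma x ^ α = (x - 1) ^ α * Real.Gamma (x - 1) ^ α := by
    rw [hrec, Real.mul_rpow hx1.le hG.le]
  rw [h3] at h2
  have hp : 0 < Real.Gamma (x - 1) ^ α := by positivity
  nlinarith

lemma ml_summable (α z : ℝ) (hα : 0 < α) :
    Summable (fun k : ℕ => z ^ k / Real.Gamma (k * α + α)) := by
  by_cases hz : z = 0
  · subst hz
    apply summable_of_ne_finset_zero (s := {0})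
    intro b hb
    have : b ≠ 0 := by simpa using hb
    simp [this]
  have hpos : ∀ k : ℕ, 0 < Real.Gamma (k * α + α) := fun k =>
    Real.Gamma_pos_of_pos (by positivity)
  apply summable_of_ratio_test_tendsto_lt_one (l := 0) one_pos
  · exact Eventually.of_forall fun k => div_ne_zero (pow_ne_zero _ hz) (hpos k).ne'
  have hlin : Tendsto (fun k : ℕ => (k : ℝ) * α + α - 1) atTop atTop := by
    have : Tendsto (fun k : ℕ => (k : ℝ) * α) atTop atTop :=
      tendsto_natCast_atTop_atTop.atTop_mul_const hα
    have h2 := tendsto_atTop_add_const_right atTop (α - 1) this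
    refine h2.congr fun k => by ring
  have hlim : Tendsto (fun k : ℕ => |z| * (((k : ℝ) * α + α - 1) ^ α)⁻¹) atTop (𝓝 0) := by
    have := (((tendsto_rpow_atTop hα).comp hlin).inv_tendsto_atTop).const_mul |z|
    simpa using this
  refine squeeze_zero' (Eventually.of_forall fun k => by positivity) ?_ hlim
  filter_upwards [hlin.eventually_gt_atTop 0] with k hk
  have hr := ml_gamma_ratio α (k * α + α) hα (by linarith)
  have e : ((k + 1 : ℕ) : ℝ) * α + α = k * α + α + α := by push_cast; ring
  rw [e]
  have hG := hpos k
  have hP : 0 < ((k : ℝ) * α + α - 1) ^ α := by positivity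
  have hG2 : 0 < Real.Gamma (k * α + α + α) := Real.Gamma_pos_of_pos (by positivity)
  have hza : 0 < |z| := abs_pos.mpr hz
  rw [norm_div, norm_div, norm_pow, norm_pow, Real.norm_eq_abs, Real.norm_of_nonneg hG.le,
    Real.norm_of_nonneg hG2.le]
  rw [pow_succ]
  have : |z| ^ k * |z| / Real.Gamma (k * α + α + α) / (|z| ^ k / Real.Gamma (k * α + α))
      = |z| * (Real.Gamma (k * α + α) / Real.Gamma (k * α + α + α)) := by
    field_simp
  rw [this]
  apply mul_le_mul_of_nonneg_left _ hza.le
  rw [div_le_iff₀ hG2, inv_mul_eq_div, le_div_iff₀ hP]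
  linarith

lemma ml_continuous (α : ℝ) (hα : 0 < α) : Continuous (fun z => mittagLeffler α α z) := by
  rw [continuous_iff_continuousAt]
  intro z
  have h : ContinuousOn (fun z => mittagLeffler α α z) (Icc (z - 1) (z + 1)) := by
    unfold mittagLeffler
    apply continuousOn_tsum (u := fun k : ℕ => (|z| + 1) ^ k / Real.Gamma (k * α + α))
    · intro k; fun_prop
    · exact ml_summable α _ hα
    · intro k x hx
      have hG : 0 < Real.Gamma (k * α + α) := Real.Gamma_pos_of_pos (by positivity)
      rw [norm_div, norm_pow, Real.norm_of_nonneg hG.le, Real.norm_eq_abs]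
      gcongr
      rw [abs_le]
      constructor
      · have := neg_abs_le z; linarith [hx.1]
      · have := le_abs_self z; linarith [hx.2]
  exact h.continuousAt (Icc_mem_nhds (by linarith) (by linarith))

lemma ml_zero (α : ℝ) : mittagLeffler α α 0 = 1 / Real.Gamma α := by
  unfold mittagLeffler
  rw [tsum_eq_single 0]
  · simp
  · intro b hb; simp [hb]

lemma ml_beta (s t a : ℝ) (hs : 0 < s) (ht : 0 < t) (ha : 0 < a) :
    ∫ x in (0:ℝ)..a, x ^ (s - 1) * (a - x) ^ (t - 1) =
      a ^ (s + t - 1) * (Real.Gamma s * Real.Gamma t / Real.Gamma (s + t)) := by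
  have h := Complex.betaIntegral_scaled (s : ℂ) (t : ℂ) ha
  rw [Complex.betaIntegral_eq_Gamma_mul_div _ _ (by simpa) (by simpa)] at h
  have e : ∫ x in (0:ℝ)..a, (x : ℂ) ^ ((s : ℂ) - 1) * ((a : ℂ) - x) ^ ((t : ℂ) - 1)
      = ∫ x in (0:ℝ)..a, ((x ^ (s - 1) * (a - x) ^ (t - 1) : ℝ) : ℂ) := by
    apply intervalIntegral.integral_congr
    intro x hx
    rw [uIcc_of_le ha.le] at hx
    have h2 : 0 ≤ a - x := by linarith [hx.2]
    simp only [Complex.ofReal_mul]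
    rw [Complex.ofReal_cpow hx.1, Complex.ofReal_cpow h2]
    push_cast; rfl
  rw [e, intervalIntegral.integral_ofReal] at h
  have e2 : (a : ℂ) ^ ((s : ℂ) + t - 1) = ((a ^ (s + t - 1) : ℝ) : ℂ) := by
    rw [Complex.ofReal_cpow ha.le]; push_cast; rfl
  rw [e2, ← Complex.ofReal_add, Complex.Gamma_ofReal, Complex.Gamma_ofReal,
    Complex.Gamma_ofReal] at h
  exact_mod_cast h

lemma ml_beta_int (s t a : ℝ) (hs : 0 < s) (ht : 0 < t) (ha : 0 < a) :
    IntervalIntegrable (fun x => x ^ (s - 1) * (a - x) ^ (t - 1)) volume 0 a := by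
  by_contra hc
  have h := ml_beta s t a hs ht ha
  rw [intervalIntegral.integral_undef hc] at h
  have h1 := Real.Gamma_pos_of_pos hs
  have h2 := Real.Gamma_pos_of_pos ht
  have h3 := Real.Gamma_pos_of_pos (add_pos hs ht)
  have : 0 < a ^ (s + t - 1) * (Real.Gamma s * Real.Gamma t / Real.Gamma (s + t)) := by positivity
  linarith

/-- Volterra equation. -/
lemma ml_volterra (α lam t : ℝ) (hα : 0 < α) (hlam : 0 < lam) (ht : 0 < t) :
    lam * ∫ s in (0:ℝ)..t, s ^ (α - 1) * (t - s) ^ (α - 1) * mittagLeffler α α (-lam * s ^ α)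
      = t ^ (α - 1) * (1 - Real.Gamma α * mittagLeffler α α (-lam * t ^ α)) := by
  have hGp : ∀ k : ℕ, 0 < Real.Gamma (k * α + α) := fun k =>
    Real.Gamma_pos_of_pos (by positivity)
  have hGa := Real.Gamma_pos_of_pos hα
  let F : ℕ → ℝ → ℝ := fun k s =>
    (s ^ (((k : ℝ) * α + α) - 1) * (t - s) ^ (α - 1)) * ((-lam) ^ k / Real.Gamma (k * α + α))
  have hFint : ∀ k : ℕ, ∀ c : ℝ, ∫ s in Ioc 0 t,
      (s ^ (((k : ℝ) * α + α) - 1) * (t - s) ^ (α - 1)) * (c ^ k / Real.Gamma (k * α + α))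
      = Real.Gamma α * t ^ (α - 1) * t ^ α *
        ((c * t ^ α) ^ k / Real.Gamma ((k + 1 : ℕ) * α + α)) := by
    intro k c
    rw [← intervalIntegral.integral_of_le ht.le, intervalIntegral.integral_mul_const,
      ml_beta _ _ _ (by positivity) hα ht]
    have e1 : t ^ ((k : ℝ) * α + α + α - 1) = t ^ (α - 1) * t ^ α * (t ^ α) ^ k := by
      rw [← Real.rpow_natCast, ← Real.rpow_mul ht.le, ← Real.rpow_add ht, ← Real.rpow_add ht]
      congr 1; ring
    have e2 : ((k + 1 : ℕ) : ℝ) * α + α = k * α + α + α := by push_cast; ring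
    rw [e1, e2, mul_pow]
    have := (hGp k).ne'
    field_simp
  have hI : ∀ k, Integrable (F k) (volume.restrict (Ioc 0 t)) := by
    intro k
    have := ml_beta_int (k * α + α) α t (by positivity) hα ht
    have := (intervalIntegrable_iff_integrableOn_Ioc_of_le ht.le).mp this
    exact this.mul_const _
  have hS : Summable fun k => ∫ s, ‖F k s‖ ∂(volume.restrict (Ioc 0 t)) := by
    have e : ∀ k, ∫ s, ‖F k s‖ ∂(volume.restrict (Ioc 0 t)) =
        Real.Gamma α * t ^ (α - 1) * t ^ α *
        ((lam * t ^ α) ^ k / Real.Gamma ((k + 1 : ℕ) * α + α)) := by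
      intro k
      rw [← hFint k lam]
      apply setIntegral_congr_fun measurableSet_Ioc
      intro s hs
      have h1 : 0 ≤ t - s := by linarith [hs.2]
      have h0 := hs.1
      simp only [F]
      rw [norm_mul, Real.norm_of_nonneg (by positivity), norm_div, norm_pow, norm_neg,
        Real.norm_of_nonneg hlam.le, Real.norm_of_nonneg (hGp k).le]
    simp_rw [e]
    apply Summable.mul_left
    have h := (summable_nat_add_iff 1).mpr (ml_summable α (lam * t ^ α) hα)
    have hne : lam * t ^ α ≠ 0 := by positivity
    have h2 := h.mul_left (lam * t ^ α)⁻¹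
    refine h2.congr fun k => ?_
    rw [pow_succ]; field_simp
  have hsum := hasSum_integral_of_summable_integral_norm hI hS
  have eL : ∫ s in (0:ℝ)..t, s ^ (α - 1) * (t - s) ^ (α - 1) * mittagLeffler α α (-lam * s ^ α)
      = ∫ s in Ioc 0 t, ∑' k, F k s := by
    rw [intervalIntegral.integral_of_le ht.le]
    apply setIntegral_congr_fun measurableSet_Ioc
    intro s hs
    have h0 : 0 < s := hs.1
    simp only [F, mittagLeffler]
    rw [← tsum_mul_left]
    congr 1
    ext k
    have e1 : s ^ ((k : ℝ) * α + α - 1) = s ^ (α - 1) * (s ^ α) ^ k := by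
      rw [← Real.rpow_natCast, ← Real.rpow_mul h0.le, ← Real.rpow_add h0]
      congr 1; ring
    rw [e1, mul_pow]; ring
  rw [eL, ← hsum.tsum_eq]
  have e3 : ∀ k, ∫ s in Ioc 0 t, F k s = Real.Gamma α * t ^ (α - 1) * t ^ α *
        ((-lam * t ^ α) ^ k / Real.Gamma ((k + 1 : ℕ) * α + α)) := fun k => hFint k (-lam)
  simp_rw [e3]
  rw [tsum_mul_left]
  have hE : mittagLeffler α α (-lam * t ^ α) = 1 / Real.Gamma α +
      (-lam * t ^ α) * ∑' k : ℕ, ((-lam * t ^ α) ^ k / Real.Gamma ((k + 1 : ℕ) * α + α)) := by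
    unfold mittagLeffler
    rw [(ml_summable α (-lam * t ^ α) hα).tsum_eq_zero_add, ← tsum_mul_left]
    simp only [pow_zero, Nat.cast_zero, zero_mul, zero_add]
    congr 1
    apply tsum_congr
    intro k
    rw [pow_succ]; ring
  rw [hE]
  field_simp
  ring

lemma ml_cont_comp (α lam : ℝ) (hα : 0 < α) :
    Continuous (fun t : ℝ => mittagLeffler α α (-lam * t ^ α)) :=
  (ml_continuous α hα).comp (continuous_const.mul (Real.continuous_rpow_const hα.le))

lemma ml_kernel_int (α lam t : ℝ) (hα : 0 < α) (ht : 0 < t) :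
    IntervalIntegrable (fun s => s ^ (α - 1) * (t - s) ^ (α - 1) *
      mittagLeffler α α (-lam * s ^ α)) volume 0 t :=
  (ml_beta_int α α t hα hα ht).mul_continuousOn (ml_cont_comp α lam hα).continuousOn

lemma ml_pos (α lam : ℝ) (hα : 0 < α) (hα1 : α < 1) (hlam : 0 < lam) (t : ℝ) (ht : 0 ≤ t) :
    0 < mittagLeffler α α (-lam * t ^ α) := by
  by_contra hneg
  push Not at hneg
  have hGa := Real.Gamma_pos_of_pos hα
  have hcont := ml_cont_comp α lam hα
  have hV := fun t => ml_volterra α lam t hα hlam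
  have hJ := fun t => ml_kernel_int α lam t hα
  have hf0 : mittagLeffler α α (-lam * (0:ℝ) ^ α) = 1 / Real.Gamma α := by
    rw [Real.zero_rpow hα.ne', mul_zero, ml_zero]
  generalize hf : (fun t : ℝ => mittagLeffler α α (-lam * t ^ α)) = f at hcont
  have hfe : ∀ t : ℝ, mittagLeffler α α (-lam * t ^ α) = f t := fun t => congrFun hf t
  simp only [hfe] at hneg hV hJ hf0
  let S : Set ℝ := {t | 0 ≤ t ∧ f t ≤ 0}
  have hSc : IsClosed S :=
    (isClosed_le continuous_const continuous_id).inter (isClosed_le hcont continuous_const)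
  have hSb : BddBelow S := ⟨0, fun x hx => hx.1⟩
  have hmem : sInf S ∈ S := hSc.csInf_mem ⟨t, ht, hneg⟩ hSb
  have hlt : ∀ s, 0 ≤ s → s < sInf S → 0 < f s := by
    intro s hs hs2
    by_contra hc
    exact absurd (csInf_le hSb (⟨hs, not_lt.mp hc⟩ : s ∈ S)) (not_le.mpr hs2)
  generalize sInf S = t0 at hmem hlt
  obtain ⟨h0, hft0⟩ := hmem
  have ht0 : 0 < t0 := by
    rcases h0.eq_or_lt with h | h
    · rw [← h, hf0] at hft0
      have : 0 < 1 / Real.Gamma α := by positivity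
      linarith
    · exact h
  have hev : ∀ᶠ t1 in 𝓝[<] t0,
      lam * (t1 ^ (α - 1) * ((t0 - t1) ^ α / α)) < Real.Gamma α * t0 ^ (α - 1) := by
    have hc : ContinuousAt (fun t1 : ℝ => lam * (t1 ^ (α - 1) * ((t0 - t1) ^ α / α))) t0 := by
      apply ContinuousAt.mul continuousAt_const
      apply ContinuousAt.mul
      · exact Real.continuousAt_rpow_const _ _ (Or.inl ht0.ne')
      · apply ContinuousAt.div_const
        exact ((Real.continuous_rpow_const hα.le).comp
          (continuous_const.sub continuous_id)).continuousAt
    have h2 : lam * (t0 ^ (α - 1) * ((t0 - t0) ^ α / α)) < Real.Gamma α * t0 ^ (α - 1) := by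
      rw [sub_self, Real.zero_rpow hα.ne']
      simp only [zero_div, mul_zero]
      positivity
    exact (hc.eventually_lt continuousAt_const h2).filter_mono nhdsWithin_le_nhds
  have hev2 : ∀ᶠ t1 in 𝓝[<] t0, t1 ∈ Ioo 0 t0 := Ioo_mem_nhdsLT ht0
  obtain ⟨t1, hs, ht1, ht1'⟩ := (hev.and hev2).exists
  obtain ⟨m, hm, hmax⟩ := isCompact_Icc.exists_isMaxOn (nonempty_Icc.mpr ht1'.le)
    (hcont.continuousOn (s := Icc t1 t0))
  have hmax' : ∀ s ∈ Icc t1 t0, f s ≤ f m := fun s hs => hmax hs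
  have hfm : 0 < f m := (hlt t1 ht1.le ht1').trans_le (hmax' t1 ⟨le_rfl, ht1'.le⟩)
  have hm0 : 0 < m := ht1.trans_le hm.1
  have hmt : m < t0 := by
    rcases hm.2.eq_or_lt with h | h
    · rw [h] at hfm; linarith
    · exact h
  have hJ0 := hJ t0 ht0
  have hJa : IntervalIntegrable (fun s => s ^ (α - 1) * (t0 - s) ^ (α - 1) * f s) volume 0 m :=
    hJ0.mono_set (by rw [uIcc_of_le hm0.le, uIcc_of_le ht0.le]; exact Icc_subset_Icc le_rfl hm.2)
  have hJb : IntervalIntegrable (fun s => s ^ (α - 1) * (t0 - s) ^ (α - 1) * f s) volume m t0 :=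
    hJ0.mono_set (by rw [uIcc_of_le hmt.le, uIcc_of_le ht0.le]; exact Icc_subset_Icc hm0.le le_rfl)
  have hA : ∫ s in (0:ℝ)..m, s ^ (α - 1) * (t0 - s) ^ (α - 1) * f s ≤
      (t0 / m) ^ (α - 1) * ∫ s in (0:ℝ)..m, s ^ (α - 1) * (m - s) ^ (α - 1) * f s := by
    rw [← intervalIntegral.integral_const_mul]
    apply intervalIntegral.integral_mono_on_of_le_Ioo hm0.le hJa ((hJ m hm0).const_mul _)
    intro s hs
    have hs0 : 0 < s := hs.1
    have hsm : 0 < m - s := by linarith [hs.2]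
    have hfs := hlt s hs0.le (hs.2.trans hmt)
    have hk : (t0 - s) ^ (α - 1) ≤ (t0 / m) ^ (α - 1) * (m - s) ^ (α - 1) := by
      rw [← Real.mul_rpow (by positivity) hsm.le]
      apply Real.rpow_le_rpow_of_nonpos (by positivity) _ (by linarith)
      rw [div_mul_eq_mul_div, div_le_iff₀ hm0]
      nlinarith
    calc s ^ (α - 1) * (t0 - s) ^ (α - 1) * f s
        ≤ s ^ (α - 1) * ((t0 / m) ^ (α - 1) * (m - s) ^ (α - 1)) * f s := by gcongr
      _ = _ := by ring
  have hgint : IntervalIntegrable (fun s : ℝ => (t0 - s) ^ (α - 1)) volume m t0 := by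
    have := (intervalIntegral.intervalIntegrable_rpow' (a := 0) (b := t0 - m) (r := α - 1)
      (by linarith)).comp_sub_left t0
    simpa using this.symm
  have hB : ∫ s in m..t0, s ^ (α - 1) * (t0 - s) ^ (α - 1) * f s ≤
      (t1 ^ (α - 1) * f m) * ((t0 - t1) ^ α / α) := by
    calc ∫ s in m..t0, s ^ (α - 1) * (t0 - s) ^ (α - 1) * f s
        ≤ ∫ s in m..t0, (t1 ^ (α - 1) * f m) * (t0 - s) ^ (α - 1) := by
          apply intervalIntegral.integral_mono_on_of_le_Ioo hmt.le hJb (hgint.const_mul _)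
          intro s hs
          have hts : 0 < t0 - s := by linarith [hs.2]
          have h1 : s ^ (α - 1) ≤ t1 ^ (α - 1) :=
            Real.rpow_le_rpow_of_nonpos ht1 (by linarith [hs.1, hm.1]) (by linarith)
          have h2 : f s ≤ f m := hmax' s ⟨by linarith [hs.1, hm.1], hs.2.le⟩
          have h3 : 0 < f s := hlt s (by linarith [hs.1]) hs.2
          calc s ^ (α - 1) * (t0 - s) ^ (α - 1) * f s
              ≤ t1 ^ (α - 1) * (t0 - s) ^ (α - 1) * f m := by gcongr
            _ = _ := by ring
      _ = (t1 ^ (α - 1) * f m) * ((t0 - m) ^ α / α) := by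
          rw [intervalIntegral.integral_const_mul,
            intervalIntegral.integral_comp_sub_left (fun x : ℝ => x ^ (α - 1)) t0,
            integral_rpow (Or.inl (by linarith))]
          simp [Real.zero_rpow hα.ne']
      _ ≤ _ := by
          have : 0 ≤ t0 - m := by linarith
          have h1 : t0 - m ≤ t0 - t1 := by linarith [hm.1]
          gcongr
  have hV0 := hV t0 ht0
  rw [← intervalIntegral.integral_add_adjacent_intervals hJa hJb] at hV0
  have hVm := hV m hm0
  have hr : (t0 / m) ^ (α - 1) * m ^ (α - 1) = t0 ^ (α - 1) := by
    rw [← Real.mul_rpow (by positivity) hm0.le, div_mul_cancel₀ _ hm0.ne']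
  have hA' : lam * ∫ s in (0:ℝ)..m, s ^ (α - 1) * (t0 - s) ^ (α - 1) * f s ≤
      t0 ^ (α - 1) * (1 - Real.Gamma α * f m) := by
    calc _ ≤ lam * ((t0 / m) ^ (α - 1) *
          ∫ s in (0:ℝ)..m, s ^ (α - 1) * (m - s) ^ (α - 1) * f s) := by gcongr
      _ = (t0 / m) ^ (α - 1) * (lam *
          ∫ s in (0:ℝ)..m, s ^ (α - 1) * (m - s) ^ (α - 1) * f s) := by ring
      _ = _ := by rw [hVm, ← mul_assoc, hr]
  have hB' := mul_le_mul_of_nonneg_left hB hlam.le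
  have hp : 0 < t0 ^ (α - 1) := by positivity
  have hle : t0 ^ (α - 1) ≤ t0 ^ (α - 1) * (1 - Real.Gamma α * f t0) := by
    have : 0 ≤ t0 ^ (α - 1) * (Real.Gamma α * -f t0) := by
      have : 0 ≤ -f t0 := by linarith
      positivity
    linarith
  have hs' := mul_lt_mul_of_pos_right hs hfm
  linarith

lemma ml_le (α lam : ℝ) (hα : 0 < α) (hα1 : α < 1) (hlam : 0 < lam) (t : ℝ) (ht : 0 < t) :
    mittagLeffler α α (-lam * t ^ α) ≤ 1 / Real.Gamma α := by
  have hGa := Real.Gamma_pos_of_pos hα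
  have hV := ml_volterra α lam t hα hlam ht
  have h0 : 0 ≤ ∫ s in (0:ℝ)..t, s ^ (α - 1) * (t - s) ^ (α - 1) *
      mittagLeffler α α (-lam * s ^ α) := by
    apply intervalIntegral.integral_nonneg ht.le
    intro s hs
    have := ml_pos α lam hα hα1 hlam s hs.1
    have h1 := hs.1
    have h2 : 0 ≤ t - s := by linarith [hs.2]
    positivity
  have h1 : 0 ≤ t ^ (α - 1) * (1 - Real.Gamma α * mittagLeffler α α (-lam * t ^ α)) := by
    rw [← hV]; positivity
  have h2 := nonneg_of_mul_nonneg_right h1 (by positivity : 0 < t ^ (α - 1))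
  rw [le_div_iff₀ hGa]; linarith

lemma ml_int (α lam T : ℝ) (hα : 0 < α) :
    IntervalIntegrable (fun s : ℝ => s ^ (α - 1) * mittagLeffler α α (-lam * s ^ α))
      volume 0 T :=
  (intervalIntegral.intervalIntegrable_rpow' (by linarith)).mul_continuousOn
    (ml_cont_comp α lam hα).continuousOn

lemma ml_L1 (α lam : ℝ) (hα : 0 < α) (hα1 : α < 1) (hlam : 0 < lam) (T : ℝ) (hT : 0 < T) :
    ∫ s in (0:ℝ)..T, s ^ (α - 1) * mittagLeffler α α (-lam * s ^ α) ≤ 1 / lam := by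
  have hGa := Real.Gamma_pos_of_pos hα
  have hV := ml_volterra α lam T hα hlam hT
  have hTp : 0 < T ^ (α - 1) := by positivity
  have h1 : T ^ (α - 1) * ∫ s in (0:ℝ)..T, s ^ (α - 1) * mittagLeffler α α (-lam * s ^ α) ≤
      ∫ s in (0:ℝ)..T, s ^ (α - 1) * (T - s) ^ (α - 1) * mittagLeffler α α (-lam * s ^ α) := by
    rw [← intervalIntegral.integral_const_mul]
    apply intervalIntegral.integral_mono_on_of_le_Ioo hT.le ((ml_int α lam T hα).const_mul _)
      (ml_kernel_int α lam T hα hT)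
    intro s hs
    have hs0 := hs.1
    have hsT : 0 < T - s := by linarith [hs.2]
    have hf := ml_pos α lam hα hα1 hlam s hs0.le
    have hk : T ^ (α - 1) ≤ (T - s) ^ (α - 1) :=
      Real.rpow_le_rpow_of_nonpos hsT (by linarith) (by linarith)
    calc _ = s ^ (α - 1) * T ^ (α - 1) * mittagLeffler α α (-lam * s ^ α) := by ring
      _ ≤ _ := by gcongr
  have hf := ml_pos α lam hα hα1 hlam T hT.le
  have h2 := mul_le_mul_of_nonneg_left h1 hlam.le
  rw [hV] at h2
  have h3 : 0 < T ^ (α - 1) * (Real.Gamma α * mittagLeffler α α (-lam * T ^ α)) := by positivity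
  rw [le_div_iff₀ hlam]
  refine le_of_mul_le_mul_left ?_ hTp
  linarith

theorem mittagLeffler_cross_covariance_bound (α T lam₀ : ℝ)
    (hα0 : 1/2 < α) (hα1 : α < 1) (hT : 0 < T) (hlam₀ : 0 < lam₀) :
    ∃ C > 0, ∀ lam > (0:ℝ),
      |∫ τ in (0:ℝ)..T, τ ^ (2*α - 2) * mittagLeffler α α (-lam₀ * τ ^ α)
          * mittagLeffler α α (-lam * τ ^ α)|
        ≤ C * lam ^ (-1 + 1/(2*α)) := by
  have hα : 0 < α := by linarith
  have hGa := Real.Gamma_pos_of_pos hα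
  obtain ⟨M, hM⟩ : ∃ M, M = 1 / Real.Gamma α := ⟨_, rfl⟩
  have hMp : 0 < M := by rw [hM]; positivity
  have ha1 : 0 < 2 * α - 1 := by linarith
  have ha2 : 0 < α - 1 / 2 := by linarith
  have hC1 : 0 < M * M * (T ^ (2 * α - 1) / (2 * α - 1)) := by positivity
  have hC2 : 0 < M * (M * (T ^ (α - 1 / 2) / (α - 1 / 2)) + 1) := by positivity
  refine ⟨M * M * (T ^ (2 * α - 1) / (2 * α - 1)) +
    M * (M * (T ^ (α - 1 / 2) / (α - 1 / 2)) + 1), by positivity, ?_⟩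
  intro lam hlam
  have hL : 0 < lam ^ (-1 + 1 / (2 * α)) := by positivity
  have hexp : -1 + 1 / (2 * α) ≤ 0 := by
    have : 1 / (2 * α) ≤ 1 := by rw [div_le_one (by positivity)]; linarith
    linarith
  rw [← Real.norm_eq_abs]
  rcases le_total lam 1 with hl | hl
  · have hL1 : 1 ≤ lam ^ (-1 + 1 / (2 * α)) := Real.one_le_rpow_of_pos_of_le_one_of_nonpos hlam hl hexp
    have hb : ‖∫ τ in (0:ℝ)..T, τ ^ (2*α - 2) * mittagLeffler α α (-lam₀ * τ ^ α)
          * mittagLeffler α α (-lam * τ ^ α)‖ ≤ ∫ τ in (0:ℝ)..T, M * M * τ ^ (2 * α - 2) := by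
      apply intervalIntegral.norm_integral_le_of_norm_le hT.le
      · refine Eventually.of_forall fun τ hτ => ?_
        have h1 := ml_pos α lam₀ hα hα1 hlam₀ τ hτ.1.le
        have h2 := ml_pos α lam hα hα1 hlam τ hτ.1.le
        have h3 := ml_le α lam₀ hα hα1 hlam₀ τ hτ.1
        have h4 := ml_le α lam hα hα1 hlam τ hτ.1
        have h5 := hτ.1
        rw [← hM] at h3 h4
        rw [Real.norm_of_nonneg (by positivity)]
        calc _ ≤ τ ^ (2 * α - 2) * M * M := by gcongr
          _ = _ := by ring
      · exact (intervalIntegral.intervalIntegrable_rpow' (by linarith)).const_mul _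
    rw [intervalIntegral.integral_const_mul, integral_rpow (Or.inl (by linarith)),
      show 2 * α - 2 + 1 = 2 * α - 1 by ring, Real.zero_rpow ha1.ne', sub_zero] at hb
    nlinarith
  · obtain ⟨δ, hδ⟩ : ∃ δ, δ = lam ^ (-1 / α) := ⟨_, rfl⟩
    have hδp : 0 < δ := by rw [hδ]; positivity
    have hi1 : IntervalIntegrable (fun τ : ℝ => M * δ ^ (α - 1 / 2) * τ ^ (α - 3 / 2))
        volume 0 T := (intervalIntegral.intervalIntegrable_rpow' (by linarith)).const_mul _
    have hi2 : IntervalIntegrable (fun τ : ℝ => δ ^ (α - 1) *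
        (τ ^ (α - 1) * mittagLeffler α α (-lam * τ ^ α))) volume 0 T :=
      (ml_int α lam T hα).const_mul _
    have hb : ‖∫ τ in (0:ℝ)..T, τ ^ (2*α - 2) * mittagLeffler α α (-lam₀ * τ ^ α)
          * mittagLeffler α α (-lam * τ ^ α)‖ ≤ ∫ τ in (0:ℝ)..T,
          M * (M * δ ^ (α - 1 / 2) * τ ^ (α - 3 / 2) + δ ^ (α - 1) *
        (τ ^ (α - 1) * mittagLeffler α α (-lam * τ ^ α))) := by
      apply intervalIntegral.norm_integral_le_of_norm_le hT.le
      · refine Eventually.of_forall fun τ hτ => ?_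
        have h1 := ml_pos α lam₀ hα hα1 hlam₀ τ hτ.1.le
        have h2 := ml_pos α lam hα hα1 hlam τ hτ.1.le
        have h3 := ml_le α lam₀ hα hα1 hlam₀ τ hτ.1
        have h4 := ml_le α lam hα hα1 hlam τ hτ.1
        have h5 := hτ.1
        rw [← hM] at h3 h4
        rw [Real.norm_of_nonneg (by positivity)]
        have key : τ ^ (2 * α - 2) * mittagLeffler α α (-lam * τ ^ α) ≤
            M * δ ^ (α - 1 / 2) * τ ^ (α - 3 / 2) + δ ^ (α - 1) *
              (τ ^ (α - 1) * mittagLeffler α α (-lam * τ ^ α)) := by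
          rcases le_total τ δ with hd | hd
          · have e : τ ^ (2 * α - 2) = τ ^ (α - 1 / 2) * τ ^ (α - 3 / 2) := by
              rw [← Real.rpow_add h5]; congr 1; ring
            have hx : 0 ≤ δ ^ (α - 1) * (τ ^ (α - 1) * mittagLeffler α α (-lam * τ ^ α)) := by
              positivity
            have : τ ^ (2 * α - 2) * mittagLeffler α α (-lam * τ ^ α) ≤
                δ ^ (α - 1 / 2) * τ ^ (α - 3 / 2) * M := by
              rw [e]; gcongr
            linarith
          · have e : τ ^ (2 * α - 2) = τ ^ (α - 1) * τ ^ (α - 1) := by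
              rw [← Real.rpow_add h5]; congr 1; ring
            have hx : 0 ≤ M * δ ^ (α - 1 / 2) * τ ^ (α - 3 / 2) := by positivity
            have hk : τ ^ (α - 1) ≤ δ ^ (α - 1) :=
              Real.rpow_le_rpow_of_nonpos hδp hd (by linarith)
            have : τ ^ (α - 1) * (τ ^ (α - 1) * mittagLeffler α α (-lam * τ ^ α)) ≤
                δ ^ (α - 1) * (τ ^ (α - 1) * mittagLeffler α α (-lam * τ ^ α)) := by gcongr
            rw [e, mul_assoc]
            linarith
        calc _ = mittagLeffler α α (-lam₀ * τ ^ α) *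
              (τ ^ (2 * α - 2) * mittagLeffler α α (-lam * τ ^ α)) := by ring
          _ ≤ M * (τ ^ (2 * α - 2) * mittagLeffler α α (-lam * τ ^ α)) := by gcongr
          _ ≤ _ := by gcongr
      · exact (hi1.add hi2).const_mul _
    rw [intervalIntegral.integral_const_mul, intervalIntegral.integral_add hi1 hi2,
      intervalIntegral.integral_const_mul, intervalIntegral.integral_const_mul,
      integral_rpow (Or.inl (by linarith)),
      show α - 3 / 2 + 1 = α - 1 / 2 by ring, Real.zero_rpow ha2.ne', sub_zero] at hb
    have hL1 := ml_L1 α lam hα hα1 hlam T hT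
    have e1 : δ ^ (α - 1 / 2) = lam ^ (-1 + 1 / (2 * α)) := by
      rw [hδ, ← Real.rpow_mul hlam.le]; congr 1; field_simp; ring
    have e2 : δ ^ (α - 1) * (1 / lam) ≤ lam ^ (-1 + 1 / (2 * α)) := by
      have : δ ^ (α - 1) * (1 / lam) = lam ^ ((-1 + 1 / (2 * α)) + (-1 + 1 / (2 * α))) := by
        rw [hδ, ← Real.rpow_mul hlam.le, one_div, ← Real.rpow_neg_one lam, ← Real.rpow_add hlam]
        congr 1; field_simp; ring
      rw [this]
      exact Real.rpow_le_rpow_of_exponent_le hl (by linarith)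
    have e3 : δ ^ (α - 1) * (∫ s in (0:ℝ)..T, s ^ (α - 1) * mittagLeffler α α (-lam * s ^ α)) ≤
        lam ^ (-1 + 1 / (2 * α)) := le_trans (by gcongr) e2
    rw [e1] at hb
    refine hb.trans ?_
    have e4 := mul_le_mul_of_nonneg_left e3 hMp.le
    have e5 := mul_pos hC1 hL
    linarith
end
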